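/- Let X be a compact set in C^n and let z_0 in X be a peak point, i.e., there exists u in PSH(X) with u(z_0) = 0 and u(w) < 0 for all w in X different from z_0. Then there exists a continuous plurisubharmonic function u in PSH^c(X) with u(z_0) = 0 and u(w) < 0 for all w in X different from z_0. -/

import Mathlib

open MeasureTheory Metric Filter Topology Set Complex
open scoped ENNReal

noncomputable section

/-- `ℂⁿ`. -/
abbrev En (n : ℕ) : Type := EuclideanSpace ℂ (Fin n)

instance (n : ℕ) : MeasurableSpace (En n) := borel _

instance (n : ℕ) : BorelSpace (En n) := ⟨rfl⟩

open Classical in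
/-- The positive part of an extended real number, as an element of `ℝ≥0∞`. -/
def epos (x : EReal) : ℝ≥0∞ := if x = ⊤ then ⊤ else ENNReal.ofReal x.toReal

/-- The integral of an `EReal`-valued function `u` against a measure `μ`, defined as the
difference of the lower integrals of the positive and negative parts of `u`. -/
def eint {α : Type*} [MeasurableSpace α] (μ : Measure α) (u : α → EReal) : EReal :=
  ((∫⁻ x, epos (u x) ∂μ : ℝ≥0∞) : EReal) - ((∫⁻ x, epos (-(u x)) ∂μ : ℝ≥0∞) : EReal)

/-- The normalized angular measure `(2π)⁻¹ dθ` on `[0, 2π)`. -/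
def thetaM : Measure ℝ :=
  (ENNReal.ofReal ((2 * Real.pi)⁻¹)) • (volume.restrict (Set.Ico (0 : ℝ) (2 * Real.pi)))

/-- A function `u` with values in `[-∞, ∞)` is plurisubharmonic on an open set `U ⊆ ℂⁿ`:
it is upper semicontinuous, `< ⊤`, and satisfies the sub-mean-value inequality on every
complex line. -/
def PshOnE {n : ℕ} (u : En n → EReal) (U : Set (En n)) : Prop :=
  UpperSemicontinuousOn u U ∧ (∀ z ∈ U, u z < ⊤) ∧
  ∀ z ∈ U, ∀ w : En n, ∀ r : ℝ, 0 < r →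
    (∀ ζ : ℂ, ‖ζ‖ ≤ r → z + ζ • w ∈ U) →
    u z ≤ eint thetaM (fun θ => u (z + (circleMap 0 r θ) • w))

/-- `μ` is a Jensen measure on `X` with barycenter `z`:  a Borel probability measure
supported on `X` such that `u z ≤ ∫ u dμ` for every function `u` continuous and
plurisubharmonic on some open neighborhood of `X`. -/
def IsJensen {n : ℕ} (X : Set (En n)) (z : En n) (μ : Measure (En n)) : Prop :=
  IsProbabilityMeasure μ ∧ μ Xᶜ = 0 ∧
  ∀ U : Set (En n), IsOpen U → X ⊆ U →
    ∀ u : En n → EReal, ContinuousOn u U → PshOnE u U → u z ≤ eint μ u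

/-- `u : X → [-∞, ∞)` is plurisubharmonic on the compact set `X` : it is upper
semicontinuous on `X`, `< ⊤` on `X`, and satisfies the subaveraging inequality with respect
to all Jensen measures on `X`. -/
def PSHe {n : ℕ} (X : Set (En n)) (u : En n → EReal) : Prop :=
  UpperSemicontinuousOn u X ∧ (∀ z ∈ X, u z < ⊤) ∧
  ∀ z ∈ X, ∀ μ : Measure (En n), IsJensen X z μ → u z ≤ eint μ u

/-- `PSH^c(X)`: continuous plurisubharmonic functions on `X`. -/
def PSHce {n : ℕ} (X : Set (En n)) (u : En n → EReal) : Prop :=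
  PSHe X u ∧ ContinuousOn u X

/-- Real-valued continuous plurisubharmonic functions on `X`. -/
def PSHcR {n : ℕ} (X : Set (En n)) (u : En n → ℝ) : Prop :=
  ContinuousOn u X ∧ PSHe X (fun x => (u x : EReal))

/-- `O_X`: the set of points `z ∈ X` whose only Jensen measure is `δ_z`. -/
def Oset {n : ℕ} (X : Set (En n)) : Set (En n) :=
  {z | z ∈ X ∧ ∀ μ : Measure (En n), IsJensen X z μ → μ = Measure.dirac z}

/-- The potential boundary `B_X`, the closure of `O_X`. -/
def Bset {n : ℕ} (X : Set (En n)) : Set (En n) := closure (Oset X)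

/-- `J^b_z(X)`: Jensen measures with barycenter `z` supported on `B_X`. -/
def IsJensenB {n : ℕ} (X : Set (En n)) (z : En n) (μ : Measure (En n)) : Prop :=
  IsJensen X z μ ∧ μ (Bset X)ᶜ = 0

/-- `ν` is subordinated to `μ` : `μ(u) ≥ ν(u)` for all `u ∈ PSH^c(X)`. -/
def Subord {n : ℕ} (X : Set (En n)) (μ ν : Measure (En n)) : Prop :=
  ∀ u : En n → EReal, PSHce X u → eint ν u ≤ eint μ u

/-- Subharmonic functions with values in `[-∞, ∞)` on an open set `U ⊆ ℂ`. -/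
def SubharmOn (u : ℂ → EReal) (U : Set ℂ) : Prop :=
  UpperSemicontinuousOn u U ∧ (∀ z ∈ U, u z < ⊤) ∧
  ∀ z ∈ U, ∀ r : ℝ, 0 < r → closedBall z r ⊆ U →
    u z ≤ eint thetaM (fun θ => u (circleMap z r θ))

/-- Harmonic (real-valued) functions on an open set `U ⊆ ℂ`: continuous functions
satisfying the mean-value equality. -/
def HarmOn (h : ℂ → ℝ) (U : Set ℂ) : Prop :=
  ContinuousOn h U ∧
  ∀ z ∈ U, ∀ r : ℝ, 0 < r → closedBall z r ⊆ U →
    h z = (2 * Real.pi)⁻¹ * ∫ θ in (0 : ℝ)..(2 * Real.pi), h (circleMap z r θ)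

/-- Superharmonic (real-valued) functions on an open set `U ⊆ ℂ`. -/
def SuperharmOn (v : ℂ → ℝ) (U : Set ℂ) : Prop :=
  LowerSemicontinuousOn v U ∧
  ∀ z ∈ U, ∀ r : ℝ, 0 < r → closedBall z r ⊆ U →
    (2 * Real.pi)⁻¹ * (∫ θ in (0 : ℝ)..(2 * Real.pi), v (circleMap z r θ)) ≤ v z

/-- The infimum of all positive superharmonic functions on the unit disk, extending
continuously to the closed disk and `≥ 1` on `A`, evaluated at `z`. -/
def hmPre (A : Set ℂ) (z : ℂ) : ℝ :=
  sInf {t : ℝ | ∃ v : ℂ → ℝ, SuperharmOn v (ball 0 1) ∧ (∀ w ∈ ball (0 : ℂ) 1, 0 < v w) ∧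
    ContinuousOn v (closedBall 0 1) ∧ (∀ w ∈ A, 1 ≤ v w) ∧ t = v z}

/-- The harmonic measure `ω(z, A, 𝔻)` of `A` with respect to the unit disk. -/
def hm (z : ℂ) (A : Set ℂ) : ℝ := Filter.liminf (fun w => hmPre A w) (𝓝 z)

open Classical in
/-- The radial limit of a map `f` at the boundary point `ζ` of the unit circle
(junk value `0` if the radial limit does not exist). -/
def bval {n : ℕ} (f : ℂ → En n) (ζ : ℂ) : En n :=
  if h : ∃ l : En n, Tendsto (fun r : ℝ => f ((r : ℂ) * ζ)) (𝓝[<] (1 : ℝ)) (𝓝 l)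
  then h.choose else 0

open Classical in
/-- The radial limit of an `EReal`-valued function on the disk at the boundary point `ζ`. -/
def bvalE (g : ℂ → EReal) (ζ : ℂ) : EReal :=
  if h : ∃ l : EReal, Tendsto (fun r : ℝ => g ((r : ℂ) * ζ)) (𝓝[<] (1 : ℝ)) (𝓝 l)
  then h.choose else 0

/-- `μ_f`: the push-forward of the normalized arclength measure on the unit circle under the
radial boundary values of `f`. -/
def bmeas {n : ℕ} (f : ℂ → En n) : Measure (En n) :=
  thetaM.map (fun θ => bval f (circleMap 0 1 θ))

/-- Weak-* convergence of a sequence of measures on `ℂⁿ`. -/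
def WeakConv {n : ℕ} (μs : ℕ → Measure (En n)) (μ : Measure (En n)) : Prop :=
  ∀ φ : BoundedContinuousFunction (En n) ℝ,
    Tendsto (fun j => ∫ x, φ x ∂(μs j)) atTop (𝓝 (∫ x, φ x ∂μ))

/-- The cluster set `cl L` of a sequence of maps of the unit disk into `ℂⁿ`. -/
def clusterSet {n : ℕ} (f : ℕ → ℂ → En n) : Set (En n) :=
  {z | ∀ r : ℝ, 0 < r → ∀ N : ℕ, ∃ j, N ≤ j ∧ ∃ ζ ∈ ball (0 : ℂ) 1, f j ζ ∈ ball z r}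

/-- A point `z` is totally essential for the sequence `f` if for every open set `V ∋ z` the
harmonic measures at `0` of `f j ⁻¹' V` stay bounded away from `0`. -/
def TotallyEssential {n : ℕ} (f : ℕ → ℂ → En n) (z : En n) : Prop :=
  ∀ V : Set (En n), IsOpen V → z ∈ V →
    0 < Filter.atTop.liminf (fun j => hm 0 ((f j ⁻¹' V) ∩ ball 0 1))

/-- A totally perfect sequence `L` of holomorphic maps of the unit disk into `ℂⁿ`: a
uniformly bounded sequence of holomorphic maps which is weak-* converging (with limit measure
`μ_L` and center `z_L`) and all of whose cluster points are totally essential. -/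
structure PerfectSeq (n : ℕ) where
  f : ℕ → ℂ → En n
  holo : ∀ j, DifferentiableOn ℂ (f j) (ball 0 1)
  bdd : ∃ C : ℝ, ∀ j, ∀ ζ ∈ ball (0 : ℂ) 1, ‖f j ζ‖ ≤ C
  μL : Measure (En n)
  conv : WeakConv (fun j => bmeas (f j)) μL
  zL : En n
  center : Tendsto (fun j => f j 0) atTop (𝓝 zL)
  ess : ∀ z ∈ clusterSet f, TotallyEssential f z

/-- `J_z^s(L)`: the measures obtained as weak-* limits of `μ_{f_{j_k} ∘ g_k}` for subsequences
`{j_k}` and holomorphic maps `g_k : 𝔻 → 𝔻` with `f_{j_k}(g_k(0)) → z`. -/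
def JsSet {n : ℕ} (L : PerfectSeq n) (z : En n) : Set (Measure (En n)) :=
  {μ | ∃ jk : ℕ → ℕ, StrictMono jk ∧ ∃ g : ℕ → ℂ → ℂ,
    (∀ k, DifferentiableOn ℂ (g k) (ball 0 1) ∧ MapsTo (g k) (ball 0 1) (ball 0 1)) ∧
    WeakConv (fun k => bmeas ((L.f (jk k)) ∘ (g k))) μ ∧
    Tendsto (fun k => L.f (jk k) (g k 0)) atTop (𝓝 z)}

/-- `J_z(L)`: the convex hull of `J_z^s(L)`. -/
def JLSet {n : ℕ} (L : PerfectSeq n) (z : En n) : Set (Measure (En n)) :=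
  {μ | ∃ (m : ℕ) (w : Fin m → ℝ) (ν : Fin m → Measure (En n)),
    (∀ i, 0 ≤ w i) ∧ (∑ i, w i = 1) ∧ (∀ i, ν i ∈ JsSet L z) ∧
    μ = ∑ i, (ENNReal.ofReal (w i)) • ν i}

/-- `u` is harmonic on the totally perfect sequence `L`. -/
def HarmonicOnL {n : ℕ} (L : PerfectSeq n) (u : En n → EReal) : Prop :=
  PSHce (clusterSet L.f) u ∧
  ∀ z ∈ clusterSet L.f, ∀ μ ∈ JLSet L z, eint μ u = u z

/-- `PSH^w(X)`: weakly plurisubharmonic functions, the upper envelopes of nonempty families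
of continuous plurisubharmonic functions on `X`. -/
def PSHw {n : ℕ} (X : Set (En n)) (u : En n → EReal) : Prop :=
  ∃ F : Set (En n → EReal), F.Nonempty ∧ (∀ v ∈ F, PSHce X v) ∧
    ∀ x ∈ X, u x = ⨆ v ∈ F, v x

/-- `u` is maximal on `X ∖ Z`: for every relatively open `V ⊆ X ∖ Z` and every
`v ∈ PSH^c(closure V)`, if `v ≤ u` on the relative boundary of `V` in `X` then `v ≤ u`
on `closure V`. -/
def MaximalOn {n : ℕ} (X Z : Set (En n)) (u : En n → EReal) : Prop :=
  ∀ W : Set (En n), IsOpen W → X ∩ W ⊆ X \ Z →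
    ∀ v : En n → EReal, PSHce (closure (X ∩ W)) v →
      (∀ x ∈ closure (X ∩ W) \ (X ∩ W), v x ≤ u x) →
      ∀ x ∈ closure (X ∩ W), v x ≤ u x

/-- Pluriharmonic continuous real-valued functions on `X`. -/
def Pluriharm {n : ℕ} (X : Set (En n)) (h : En n → ℝ) : Prop :=
  ContinuousOn h X ∧
  ∀ z ∈ X, ∀ μ : Measure (En n), IsJensen X z μ → (h z : EReal) = eint μ (fun x => (h x : EReal))

/-- `X` is a Poisson set: every continuous real-valued function on `B_X` extends to a
pluriharmonic function on `X`. -/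
def PoissonSet {n : ℕ} (X : Set (En n)) : Prop :=
  ∀ φ : En n → ℝ, ContinuousOn φ (Bset X) →
    ∃ h : En n → ℝ, Pluriharm X h ∧ ∀ w ∈ Bset X, h w = φ w

end

section PeakFunctions

variable {Y : Type*} [TopologicalSpace Y] [CompactSpace Y]

/-- Every positive functional on `C(Y, ℝ)` is integration against a finite measure. -/
theorem exists_finiteMeasure_of_positive [T2Space Y] [MeasurableSpace Y] [BorelSpace Y]
    (L : C(Y, ℝ) →ₗ[ℝ] ℝ) (hL : ∀ f, 0 ≤ f → 0 ≤ L f) :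
    ∃ μ : Measure Y, IsFiniteMeasure μ ∧ ∀ f : C(Y, ℝ), ∫ x, f x ∂μ = L f := by
  let Λ : CompactlySupportedContinuousMap Y ℝ →ₚ[ℝ] ℝ := PositiveLinearMap.mk₀
    { toFun := fun g => L g.toContinuousMap
      map_add' := fun g g' => L.map_add g.toContinuousMap g'.toContinuousMap
      map_smul' := fun c g => L.map_smul c g.toContinuousMap }
    (fun g hg => hL _ hg)
  refine ⟨RealRMK.rieszMeasure Λ, inferInstance, fun f => ?_⟩
  exact RealRMK.integral_rieszMeasure Λ ⟨f, HasCompactSupport.of_compactSpace _⟩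

/-- If evaluation at `z` is the only probability measure dominating evaluation at `z` on a cone
`K` containing the constants, then every continuous function vanishing at `z` is, up to `ε`,
minorized by an element of `K` vanishing at `z`. -/
theorem exists_mem_le_add_of_unique_measure [T2Space Y] [MeasurableSpace Y] [BorelSpace Y]
    (K : PointedCone ℝ C(Y, ℝ)) (hconst : ∀ c : ℝ, ContinuousMap.const Y c ∈ K) (z : Y)
    (huniq : ∀ μ : Measure Y, IsProbabilityMeasure μ → (∀ f ∈ K, f z ≤ ∫ x, f x ∂μ) →
      ∀ f : C(Y, ℝ), ∫ x, f x ∂μ = f z)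
    (f : C(Y, ℝ)) (hf : f z = 0) {ε : ℝ} (hε : 0 < ε) :
    ∃ h ∈ K, h z = 0 ∧ ∀ x, h x ≤ f x + ε := by
  let S : PointedCone ℝ C(Y, ℝ) :=
    { carrier := {g | ∃ h ∈ K, 0 ≤ h z ∧ ∀ x, h x ≤ g x}
      add_mem' := by
        rintro a b ⟨h, hK, h0, hle⟩ ⟨h', hK', h0', hle'⟩
        exact ⟨h + h', K.add_mem hK hK', add_nonneg h0 h0', fun x => add_le_add (hle x) (hle' x)⟩
      zero_mem' := ⟨0, K.zero_mem, le_rfl, fun x => le_rfl⟩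
      smul_mem' := by
        rintro c g ⟨h, hK, h0, hle⟩
        exact ⟨c • h, K.smul_mem c.2 hK, mul_nonneg c.2 h0,
          fun x => mul_le_mul_of_nonneg_left (hle x) c.2⟩ }
  have hSK : ∀ h ∈ K, h - ContinuousMap.const Y (h z) ∈ S := fun h hK =>
    ⟨h + ContinuousMap.const Y (-h z), K.add_mem hK (hconst _), by simp, fun x => by
      simp [sub_eq_add_neg]⟩
  have hSpos : ∀ g : C(Y, ℝ), 0 ≤ g → g ∈ S := fun g hg => ⟨0, K.zero_mem, le_rfl, hg⟩
  have key : ∀ g : C(Y, ℝ), 0 < g z → g ∈ Submodule.closure S := by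
    intro g hg
    by_contra hgS
    obtain ⟨L, hL, hLg⟩ := ProperCone.hyperplane_separation_point _ hgS
    have hLS : ∀ h ∈ S, 0 ≤ L h := fun h hh => hL h (subset_closure hh)
    obtain ⟨μ, hμ, hint⟩ := exists_finiteMeasure_of_positive (L : C(Y, ℝ) →ₗ[ℝ] ℝ)
      (fun h hh => hLS h (hSpos h hh))
    have hint' : ∀ h : C(Y, ℝ), ∫ x, h x ∂μ = L h := hint
    have hμ0 : NeZero μ := ⟨by
      rintro rfl
      have := hint' g
      simp only [integral_zero_measure] at this
      linarith⟩
    have hreal : 0 < μ.real univ := by simp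
    have hnorm : ∀ h : C(Y, ℝ), ∫ x, h x ∂((μ univ)⁻¹ • μ) = (μ.real univ)⁻¹ * L h := by
      intro h
      rw [integral_smul_measure, hint', ENNReal.toReal_inv, smul_eq_mul, Measure.real]
    have heval := huniq ((μ univ)⁻¹ • μ) inferInstance (fun h hK => by
      have h1 := hLS _ (hSK h hK)
      rw [map_sub, ← hint' (ContinuousMap.const Y (h z))] at h1
      simp only [ContinuousMap.const_apply, integral_const, smul_eq_mul] at h1
      rw [hnorm, le_inv_mul_iff₀ hreal]
      linarith) g
    rw [hnorm] at heval
    have := mul_neg_of_pos_of_neg (inv_pos.2 hreal) hLg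
    linarith
  have hmem := key (f + ContinuousMap.const Y (ε / 2)) (by simp [hf, hε])
  obtain ⟨g, ⟨h, hK, h0, hle⟩, hg⟩ := Metric.mem_closure_iff.1
    (show f + ContinuousMap.const Y (ε / 2) ∈ closure (S : Set C(Y, ℝ)) from hmem)
    (ε / 2) (half_pos hε)
  refine ⟨h + ContinuousMap.const Y (-h z), K.add_mem hK (hconst _), by simp, fun x => ?_⟩
  have h1 := (ContinuousMap.dist_apply_le_dist x).trans_lt hg
  rw [Real.dist_eq, abs_lt] at h1
  have h2 := hle x
  simp only [ContinuousMap.add_apply, ContinuousMap.const_apply] at h1 ⊢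
  linarith

end PeakFunctions

/-- Bishop's construction: in a closed max-stable cone of continuous functions, approximate peak
functions at a point can be combined into an exact one. -/
theorem exists_peak_of_approx_peak {Y : Type*} [MetricSpace Y] [CompactSpace Y]
    (K : PointedCone ℝ C(Y, ℝ)) (hconst : ∀ c : ℝ, ContinuousMap.const Y c ∈ K)
    (hsup : ∀ f ∈ K, ∀ g ∈ K, f ⊔ g ∈ K) (hclosed : IsClosed (K : Set C(Y, ℝ))) (z : Y)
    (happrox : ∀ f : C(Y, ℝ), f z = 0 → ∀ ε : ℝ, 0 < ε →
      ∃ h ∈ K, h z = 0 ∧ ∀ x, h x ≤ f x + ε) :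
    ∃ v ∈ K, v z = 0 ∧ ∀ w, w ≠ z → v w < 0 := by
  have hh : ∀ r : ℝ, 0 < r → ∃ h ∈ K, h z = 0 ∧ (∀ x, -1 ≤ h x) ∧ (∀ x, h x ≤ 1 / 4) ∧
      ∀ x, r ≤ dist x z → h x ≤ -1 := by
    intro r hr
    obtain ⟨h, hK, h0, hle⟩ := happrox ⟨fun x => -(2 / r) * dist x z, by fun_prop⟩ (by simp)
      (1 / 4) (by norm_num)
    simp only [ContinuousMap.coe_mk] at hle
    refine ⟨h ⊔ ContinuousMap.const Y (-1), hsup _ hK _ (hconst _), by simp [h0],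
      fun x => by simp, fun x => ?_, fun x hx => ?_⟩
    · have : 0 ≤ 2 / r * dist x z := by positivity
      simp only [ContinuousMap.sup_apply, ContinuousMap.const_apply, sup_le_iff]
      exact ⟨by linarith [hle x], by norm_num⟩
    · have : 2 / r * r ≤ 2 / r * dist x z := by gcongr
      rw [div_mul_cancel₀ _ hr.ne'] at this
      simp only [ContinuousMap.sup_apply, ContinuousMap.const_apply, sup_le_iff]
      exact ⟨by linarith [hle x], le_rfl⟩
  let P : ℕ → C(Y, ℝ) × ℝ → Prop := fun k s => s.1 ∈ K ∧ s.1 z = 0 ∧ 0 < s.2 ∧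
    ∀ x, dist x z < s.2 → s.1 x ≤ (1 / 2) ^ k * (1 / 2)
  let R : ℕ → C(Y, ℝ) × ℝ → C(Y, ℝ) × ℝ → Prop := fun k s t => t.2 ≤ s.2 / 2 ∧
    (∀ x, |t.1 x - s.1 x| ≤ (1 / 2) ^ k) ∧ (∀ x, t.1 x ≤ s.1 x + (1 / 2) ^ k * (1 / 4)) ∧
    ∀ x, s.2 ≤ dist x z → t.1 x ≤ s.1 x - (1 / 2) ^ k
  have hstep : ∀ k s, P k s → ∃ t, P (k + 1) t ∧ R k s t := by
    rintro k ⟨f, r⟩ ⟨hfK, hf0, hr, -⟩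
    obtain ⟨h, hK, h0, hge, hle, hfar⟩ := hh r hr
    have hk : (0 : ℝ) < (1 / 2) ^ k := by positivity
    set g : C(Y, ℝ) := f + ((1 / 2 : ℝ) ^ k) • h with hg
    have hgx : ∀ x, g x = f x + (1 / 2) ^ k * h x := fun x => by simp [hg]
    have hg0 : g z = 0 := by simp [hgx, hf0, h0]
    have hnhds : ∀ᶠ x in 𝓝 z, g x < (1 / 2) ^ (k + 1) * (1 / 2) :=
      g.continuous.continuousAt.eventually_lt_const (by rw [hg0]; positivity)
    obtain ⟨ρ, hρ, hball⟩ := Metric.eventually_nhds_iff.1 hnhds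
    refine ⟨(g, min ρ (r / 2)), ⟨K.add_mem hfK (K.smul_mem hk.le hK), hg0,
      lt_min hρ (half_pos hr), fun x hx => (hball (hx.trans_le (min_le_left _ _))).le⟩,
      min_le_right _ _, fun x => ?_, fun x => ?_, fun x hx => ?_⟩
    · rw [hgx, add_sub_cancel_left, abs_mul, abs_of_pos hk]
      exact mul_le_of_le_one_right hk.le (abs_le.2 ⟨hge x, (hle x).trans (by norm_num)⟩)
    · simp only [hgx]
      gcongr
      exact hle x
    · simp only [hgx]
      nlinarith [hfar x hx]
  choose! next hnextP hnextR using hstep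
  let σ : ℕ → C(Y, ℝ) × ℝ := fun k => Nat.rec (0, 1) (fun k s => next k s) k
  have hσP : ∀ k, P k (σ k) := by
    intro k
    induction k with
    | zero => exact ⟨K.zero_mem, rfl, one_pos, fun x _ => by simp [σ]⟩
    | succ k ih => exact hnextP k _ ih
  have hσR : ∀ k, R k (σ k) (σ (k + 1)) := fun k => hnextR k _ (hσP k)
  have hcauchy : CauchySeq fun k => (σ k).1 :=
    cauchySeq_of_le_geometric (1 / 2) 1 (by norm_num) fun k => by
      rw [one_mul, ContinuousMap.dist_le (by positivity)]
      intro x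
      rw [dist_comm, Real.dist_eq]
      exact (hσR k).2.1 x
  obtain ⟨v, hv⟩ := cauchySeq_tendsto_of_complete hcauchy
  have hvx : ∀ x, Tendsto (fun k => (σ k).1 x) atTop (𝓝 (v x)) := fun x =>
    ((continuous_eval_const (F := C(Y, ℝ)) x).tendsto v).comp hv
  refine ⟨v, hclosed.mem_of_tendsto hv (Eventually.of_forall fun k => (hσP k).1),
    tendsto_nhds_unique (hvx z) (by simp [fun k => (hσP k).2.1]), fun w hw => ?_⟩
  have hrad : ∀ k, (σ k).2 ≤ (1 / 2) ^ k := by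
    intro k
    induction k with
    | zero => simp [σ]
    | succ k ih => exact (hσR k).1.trans (by rw [pow_succ]; linarith)
  have hex : ∃ k, (σ k).2 ≤ dist w z := by
    obtain ⟨k, hk⟩ := exists_pow_lt_of_lt_one (dist_pos.2 hw) (by norm_num : (1 / 2 : ℝ) < 1)
    exact ⟨k, (hrad k).trans hk.le⟩
  classical
  set m := Nat.find hex
  have hanti : ∀ j, m ≤ j → (σ j).2 ≤ dist w z := by
    intro j hj
    induction j, hj using Nat.le_induction with
    | base => exact Nat.find_spec hex
    | succ j _ ih =>
      have := (hσP j).2.2.1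
      exact (hσR j).1.trans (by linarith)
  have hdec : ∀ j, m ≤ j → (σ j).1 w ≤ (σ m).1 w - (2 * (1 / 2) ^ m - 2 * (1 / 2) ^ j) := by
    intro j hj
    induction j, hj using Nat.le_induction with
    | base => simp
    | succ j hj ih =>
      have := (hσR j).2.2.2 w (hanti j hj)
      rw [pow_succ]
      linarith
  have hstart : (σ m).1 w ≤ (1 / 2) ^ m * (3 / 2) := by
    rcases hmk : m with _ | k
    · norm_num [σ]
    · have hlt : dist w z < (σ k).2 := not_le.1 (Nat.find_min hex (by omega))
      have h1 := (hσP k).2.2.2 w hlt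
      have h2 := (hσR k).2.2.1 w
      rw [pow_succ]
      linarith
  have hlim : v w ≤ (σ m).1 w - (2 * (1 / 2) ^ m - 2 * 0) :=
    le_of_tendsto_of_tendsto (hvx w)
      (((tendsto_pow_atTop_nhds_zero_of_lt_one (by norm_num) (by norm_num :
        (1 / 2 : ℝ) < 1)).const_mul 2).const_sub _ |>.const_sub _)
      (eventually_atTop.2 ⟨m, hdec⟩)
  have : (0 : ℝ) < (1 / 2) ^ m := by positivity
  linarith

theorem epos_eq_toENNReal : epos = EReal.toENNReal := rfl

theorem eint_map {α β : Type*} [MeasurableSpace α] [MeasurableSpace β] {e : α → β}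
    (he : MeasurableEmbedding e) (ν : Measure α) (u : β → EReal) :
    eint (ν.map e) u = eint ν (u ∘ e) := by
  simp only [eint, he.lintegral_map, Function.comp_apply]

theorem eint_coe {α : Type*} [MeasurableSpace α] {ν : Measure α} {f : α → ℝ}
    (hf : Integrable f ν) : eint ν (fun x => (f x : EReal)) = ((∫ x, f x ∂ν : ℝ) : EReal) := by
  have h1 : ∫⁻ x, ENNReal.ofReal (f x) ∂ν ≠ ⊤ := hf.lintegral_lt_top.ne
  have h2 : ∫⁻ x, ENNReal.ofReal (-f x) ∂ν ≠ ⊤ := hf.neg.lintegral_lt_top.ne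
  rw [integral_eq_lintegral_pos_part_sub_lintegral_neg_part hf, EReal.coe_sub,
    EReal.coe_ennreal_toReal h1, EReal.coe_ennreal_toReal h2]
  simp only [eint, epos_eq_toENNReal, ← EReal.coe_neg, EReal.real_coe_toENNReal]

theorem eint_mono {α : Type*} [MeasurableSpace α] {ν : Measure α} {u v : α → EReal}
    (h : ∀ x, u x ≤ v x) : eint ν u ≤ eint ν v := by
  simp only [eint, epos_eq_toENNReal]
  refine EReal.sub_le_sub ?_ ?_
  · exact EReal.coe_ennreal_le_coe_ennreal_iff.2
      (lintegral_mono fun x => EReal.toENNReal_le_toENNReal (h x))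
  · exact EReal.coe_ennreal_le_coe_ennreal_iff.2
      (lintegral_mono fun x => EReal.toENNReal_le_toENNReal (EReal.neg_le_neg_iff.2 (h x)))

theorem tendsto_eint_max_neg_nat {α : Type*} [MeasurableSpace α] {ν : Measure α} {g : α → EReal}
    (hg : Measurable g) (hfin : ∫⁻ x, epos (g x) ∂ν ≠ ⊤) :
    Tendsto (fun k : ℕ => eint ν (fun x => max (g x) ((-(k : ℝ) : ℝ) : EReal))) atTop
      (𝓝 (eint ν g)) := by
  simp only [eint, epos_eq_toENNReal] at hfin ⊢
  have hpos : ∀ (k : ℕ) x, (max (g x) ((-(k : ℝ) : ℝ) : EReal)).toENNReal = (g x).toENNReal := by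
    intro k x
    have hmono : Monotone EReal.toENNReal := fun _ _ h => EReal.toENNReal_le_toENNReal h
    rw [hmono.map_max, EReal.real_coe_toENNReal, ENNReal.ofReal_of_nonpos (by simp)]
    simp
  simp only [hpos]
  have hbot : Tendsto (fun k : ℕ => ((-(k : ℝ) : ℝ) : EReal)) atTop (𝓝 ⊥) :=
    EReal.tendsto_coe_nhds_bot_iff.2 (tendsto_neg_atTop_atBot.comp tendsto_natCast_atTop_atTop)
  have hneg : Tendsto (fun k : ℕ => ∫⁻ x, (-max (g x) ((-(k : ℝ) : ℝ) : EReal)).toENNReal ∂ν) atTop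
      (𝓝 (∫⁻ x, (-g x).toENNReal ∂ν)) := by
    refine lintegral_tendsto_of_tendsto_of_monotone (fun k => ?_) (ae_of_all _ fun x => ?_)
      (ae_of_all _ fun x => ?_)
    · exact (EReal.continuous_toENNReal.measurable.comp
        (continuous_neg.measurable.comp (hg.max measurable_const))).aemeasurable
    · intro j k hjk
      refine EReal.toENNReal_le_toENNReal (EReal.neg_le_neg_iff.2 (max_le_max le_rfl ?_))
      exact EReal.coe_le_coe_iff.2 (neg_le_neg (by exact_mod_cast hjk))
    · have h1 : Tendsto (fun k : ℕ => max (g x) ((-(k : ℝ) : ℝ) : EReal)) atTop (𝓝 (g x)) := by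
        simpa using tendsto_const_nhds.max hbot
      exact (EReal.continuous_toENNReal.tendsto _).comp ((continuous_neg.tendsto _).comp h1)
  have hadd := (EReal.continuousAt_add
    (p := (((∫⁻ x, (g x).toENNReal ∂ν : ℝ≥0∞) : EReal),
      -((∫⁻ x, (-g x).toENNReal ∂ν : ℝ≥0∞) : EReal)))
    (Or.inl (by simpa using hfin)) (Or.inl (by simp))).tendsto
  exact hadd.comp (tendsto_const_nhds.prodMk_nhds ((continuous_neg.tendsto _).comp
    ((continuous_coe_ennreal_ereal.tendsto _).comp hneg)))

theorem ae_nonneg_of_eint_nonneg {α : Type*} [MeasurableSpace α] {ν : Measure α} {g : α → EReal}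
    (hg : Measurable g) (hle : ∀ x, g x ≤ 0) (h : 0 ≤ eint ν g) : ∀ᵐ x ∂ν, 0 ≤ g x := by
  simp only [eint, epos_eq_toENNReal, fun x => EReal.toENNReal_of_nonpos (hle x), lintegral_zero,
    EReal.coe_ennreal_zero, zero_sub, EReal.le_neg, neg_zero] at h
  have hmeas : Measurable fun x => (-g x).toENNReal :=
    EReal.continuous_toENNReal.measurable.comp (continuous_neg.measurable.comp hg)
  have h0 : ∫⁻ x, (-g x).toENNReal ∂ν = 0 :=
    le_antisymm (by exact_mod_cast h) bot_le
  filter_upwards [(lintegral_eq_zero_iff hmeas).1 h0] with x hx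
  have := EReal.toENNReal_eq_zero_iff.1 hx
  simpa using EReal.neg_le_neg_iff.2 this

section Truncation

variable {Y : Type*} [TopologicalSpace Y]

/-- The continuous function `max g (-k)`, for `g` continuous with values in `[-∞, ∞)`. -/
noncomputable def truncBelow (g : Y → EReal) (hg : Continuous g) (htop : ∀ x, g x < ⊤) (k : ℕ) : C(Y, ℝ) where
  toFun x := (max (g x) ((-(k : ℝ) : ℝ) : EReal)).toReal
  continuous_toFun := continuous_iff_continuousAt.2 fun x =>
    (EReal.tendsto_toReal (max_lt (htop x) (EReal.coe_lt_top _)).ne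
      (lt_max_of_lt_right (EReal.bot_lt_coe _)).ne').comp
      ((hg.max continuous_const).tendsto x)

theorem coe_truncBelow {g : Y → EReal} (hg : Continuous g) (htop : ∀ x, g x < ⊤) (k : ℕ) (x : Y) :
    (truncBelow g hg htop k x : EReal) = max (g x) ((-(k : ℝ) : ℝ) : EReal) :=
  EReal.coe_toReal (max_lt (htop x) (EReal.coe_lt_top _)).ne
    (lt_max_of_lt_right (EReal.bot_lt_coe _)).ne'

variable [CompactSpace Y] [MeasurableSpace Y] [BorelSpace Y]

theorem integrable_continuousMap (f : C(Y, ℝ)) (ν : Measure Y) [IsFiniteMeasure ν] :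
    Integrable f ν :=
  f.continuous.integrable_of_hasCompactSupport (HasCompactSupport.of_compactSpace _)

theorem eint_truncBelow {g : Y → EReal} (hg : Continuous g) (htop : ∀ x, g x < ⊤) (k : ℕ)
    (ν : Measure Y) [IsFiniteMeasure ν] :
    eint ν (fun x => max (g x) ((-(k : ℝ) : ℝ) : EReal)) =
      ((∫ x, truncBelow g hg htop k x ∂ν : ℝ) : EReal) := by
  rw [← eint_coe (integrable_continuousMap _ ν)]
  simp only [coe_truncBelow]

theorem truncBelow_le_integral {g : Y → EReal} (hg : Continuous g) (htop : ∀ x, g x < ⊤) (k : ℕ)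
    (ν : Measure Y) [IsProbabilityMeasure ν] {z : Y} (h : g z ≤ eint ν g) :
    truncBelow g hg htop k z ≤ ∫ x, truncBelow g hg htop k x ∂ν := by
  rw [← EReal.coe_le_coe_iff, coe_truncBelow]
  refine max_le ?_ ?_
  · rw [← eint_truncBelow]
    exact h.trans (eint_mono fun x => le_max_left _ _)
  · rw [EReal.coe_le_coe_iff]
    have hle : ∫ _, (-(k : ℝ)) ∂ν ≤ ∫ x, truncBelow g hg htop k x ∂ν :=
      integral_mono (integrable_const _) (integrable_continuousMap _ ν) fun x =>
        EReal.coe_le_coe_iff.1 (by rw [coe_truncBelow]; exact le_max_right _ _)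
    simpa using hle

theorem le_eint_of_forall_truncBelow {g : Y → EReal} (hg : Continuous g) (htop : ∀ x, g x < ⊤)
    (ν : Measure Y) [IsFiniteMeasure ν] {z : Y}
    (h : ∀ k, truncBelow g hg htop k z ≤ ∫ x, truncBelow g hg htop k x ∂ν) :
    g z ≤ eint ν g := by
  have hfin : ∫⁻ x, epos (g x) ∂ν ≠ ⊤ := by
    refine ((lintegral_mono fun x => ?_).trans_lt
      (integrable_continuousMap (truncBelow g hg htop 0) ν).lintegral_lt_top).ne
    rw [epos_eq_toENNReal, ← EReal.real_coe_toENNReal, coe_truncBelow]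
    exact EReal.toENNReal_le_toENNReal (le_max_left _ _)
  refine ge_of_tendsto (tendsto_eint_max_neg_nat hg.measurable hfin)
    (Eventually.of_forall fun k => ?_)
  rw [eint_truncBelow hg htop]
  exact (le_max_left _ _).trans ((coe_truncBelow hg htop k z).symm.le.trans
    (EReal.coe_le_coe_iff.2 (h k)))

/-- The cone of continuous functions that are subaveraging for a family of probability measures
attached to each point. -/
def subaveragingCone (M : Y → Set (ProbabilityMeasure Y)) : PointedCone ℝ C(Y, ℝ) where
  carrier := {f | ∀ z, ∀ ν ∈ M z, f z ≤ ∫ x, f x ∂(ν : Measure Y)}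
  add_mem' := by
    intro f g hf hg z ν hν
    have := integral_add (integrable_continuousMap f (ν : Measure Y))
      (integrable_continuousMap g (ν : Measure Y))
    simp only [ContinuousMap.add_apply, this]
    exact add_le_add (hf z ν hν) (hg z ν hν)
  zero_mem' := by simp
  smul_mem' := by
    intro c f hf z ν hν
    have := integral_const_mul (μ := (ν : Measure Y)) (c : ℝ) f
    change (c : ℝ) * f z ≤ ∫ x, (c : ℝ) * f x ∂(ν : Measure Y)
    rw [this]
    exact mul_le_mul_of_nonneg_left (hf z ν hν) c.2

theorem mem_subaveragingCone {M : Y → Set (ProbabilityMeasure Y)} {f : C(Y, ℝ)} :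
    f ∈ subaveragingCone M ↔ ∀ z, ∀ ν ∈ M z, f z ≤ ∫ x, f x ∂(ν : Measure Y) := Iff.rfl

theorem const_mem_subaveragingCone (M : Y → Set (ProbabilityMeasure Y)) (c : ℝ) :
    ContinuousMap.const Y c ∈ subaveragingCone M := by
  simp [mem_subaveragingCone]

theorem sup_mem_subaveragingCone {M : Y → Set (ProbabilityMeasure Y)} {f g : C(Y, ℝ)}
    (hf : f ∈ subaveragingCone M) (hg : g ∈ subaveragingCone M) : f ⊔ g ∈ subaveragingCone M := by
  intro z ν hν
  refine sup_le ((hf z ν hν).trans ?_) ((hg z ν hν).trans ?_)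
  · exact integral_mono (integrable_continuousMap _ _) (integrable_continuousMap _ _)
      fun x => le_sup_left
  · exact integral_mono (integrable_continuousMap _ _) (integrable_continuousMap _ _)
      fun x => le_sup_right

theorem isClosed_subaveragingCone (M : Y → Set (ProbabilityMeasure Y)) :
    IsClosed (subaveragingCone M : Set C(Y, ℝ)) := by
  refine isClosed_of_closure_subset fun f hf z ν hν => le_of_forall_pos_le_add fun ε hε => ?_
  obtain ⟨g, hg, hfg⟩ := Metric.mem_closure_iff.1 hf (ε / 2) (half_pos hε)
  have hx : ∀ x, |f x - g x| < ε / 2 := fun x =>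
    (ContinuousMap.dist_apply_le_dist x).trans_lt hfg
  have h1 : ∫ x, (g x - ε / 2) ∂(ν : Measure Y) ≤ ∫ x, f x ∂(ν : Measure Y) :=
    integral_mono ((integrable_continuousMap g _).sub (integrable_const _))
      (integrable_continuousMap f _) fun x => by linarith [(abs_lt.1 (hx x)).1]
  rw [integral_sub (integrable_continuousMap g _) (integrable_const _), integral_const] at h1
  simp only [probReal_univ, one_smul] at h1
  linarith [(abs_lt.1 (hx z)).2, hg z ν hν]

end Truncation

section JensenMeasures

variable {n : ℕ} {X : Set (En n)}

/-- The Jensen measures on `X` with barycenter `z`, as probability measures on the subtype. -/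
def jensenOn (X : Set (En n)) (z : X) : Set (ProbabilityMeasure X) :=
  {ν | IsJensen X z ((ν : Measure X).map Subtype.val)}

theorem IsJensen.exists_jensenOn (hX : MeasurableSet X) {z : X} {μ : Measure (En n)}
    (hμ : IsJensen X z μ) : ∃ ν ∈ jensenOn X z, μ = (ν : Measure X).map Subtype.val := by
  have hmap : (μ.comap ((↑) : X → En n)).map Subtype.val = μ := by
    rw [map_comap_subtype_coe hX, Measure.restrict_eq_self_of_ae_mem]
    exact hμ.2.1
  have hprob : IsProbabilityMeasure (μ.comap ((↑) : X → En n)) := ⟨by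
    have := hμ.1.measure_univ
    rwa [← hmap, Measure.map_apply measurable_subtype_coe MeasurableSet.univ, preimage_univ]
      at this⟩
  refine ⟨⟨μ.comap ((↑) : X → En n), hprob⟩, ?_, hmap.symm⟩
  change IsJensen X z ((μ.comap ((↑) : X → En n)).map Subtype.val)
  rwa [hmap]

/-- A probability measure dominating evaluation at `z` on the subaveraging functions is a Jensen
measure with barycenter `z`. -/
theorem isJensen_map_of_subaveraging (hX : IsCompact X) [CompactSpace X] (z : X) (μ : Measure X)
    [IsProbabilityMeasure μ]
    (h : ∀ f ∈ subaveragingCone (jensenOn X), f z ≤ ∫ x, f x ∂μ) :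
    IsJensen X z (μ.map Subtype.val) := by
  have hemb := MeasurableEmbedding.subtype_coe hX.measurableSet
  refine ⟨Measure.isProbabilityMeasure_map measurable_subtype_coe.aemeasurable, ?_,
    fun U _ hXU g hg hpsh => ?_⟩
  · rw [hemb.map_apply]
    simp
  · have hcont : Continuous (g ∘ ((↑) : X → En n)) :=
      continuousOn_iff_continuous_domRestrict.1 (hg.mono hXU)
    have htop : ∀ x : X, (g ∘ ((↑) : X → En n)) x < ⊤ := fun x => hpsh.2.1 x (hXU x.2)
    rw [eint_map hemb]
    refine le_eint_of_forall_truncBelow hcont htop μ (z := z) fun k => h _ fun x ν hν => ?_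
    refine truncBelow_le_integral hcont htop k _ ?_
    rw [← eint_map hemb]
    exact hν.2.2 U ‹_› hXU g hg hpsh

/-- A continuous subaveraging function on `X` extends by zero to a member of `PSH^c(X)`. -/
theorem psHce_extend (hX : IsCompact X) [CompactSpace X] {v : C(X, ℝ)}
    (hv : v ∈ subaveragingCone (jensenOn X)) :
    PSHce X (Function.extend Subtype.val (fun x => (v x : EReal)) 0) := by
  set F : En n → EReal := Function.extend Subtype.val (fun x => (v x : EReal)) 0
  have hF : ∀ x : X, F x = v x := fun x => Subtype.val_injective.extend_apply _ _ x
  have hcont : ContinuousOn F X := by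
    rw [continuousOn_iff_continuous_domRestrict]
    refine (continuous_coe_real_ereal.comp v.continuous).congr fun x => (hF x).symm
  refine ⟨⟨hcont.upperSemicontinuousOn, fun z hz => ?_, fun z hz μ hμ => ?_⟩, hcont⟩
  · rw [hF ⟨z, hz⟩]
    exact EReal.coe_lt_top _
  · obtain ⟨ν, hν, rfl⟩ := IsJensen.exists_jensenOn hX.measurableSet (z := ⟨z, hz⟩) hμ
    rw [eint_map (MeasurableEmbedding.subtype_coe hX.measurableSet), hF ⟨z, hz⟩,
      show F ∘ ((↑) : X → En n) = fun x => (v x : EReal) from funext hF,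
      eint_coe (integrable_continuousMap v _), EReal.coe_le_coe_iff]
    exact hv _ ν hν

end JensenMeasures

/-- Lemma 4.1: a peak point admits a continuous plurisubharmonic peak function. -/
theorem stmt_6 {n : ℕ} (X : Set (En n)) (hX : IsCompact X) (z0 : En n) (hz0 : z0 ∈ X)
    (u : En n → EReal) (hu : PSHe X u) (hu0 : u z0 = 0)
    (huneg : ∀ w ∈ X, w ≠ z0 → u w < 0) :
    ∃ v : En n → EReal, PSHce X v ∧ v z0 = 0 ∧ ∀ w ∈ X, w ≠ z0 → v w < 0 := by
  have : CompactSpace X := isCompact_iff_compactSpace.1 hX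
  have hemb := MeasurableEmbedding.subtype_coe hX.measurableSet
  have hconst := const_mem_subaveragingCone (jensenOn X)
  have huniq : ∀ μ : Measure X, IsProbabilityMeasure μ →
      (∀ f ∈ subaveragingCone (jensenOn X), f ⟨z0, hz0⟩ ≤ ∫ x, f x ∂μ) →
      ∀ f : C(X, ℝ), ∫ x, f x ∂μ = f ⟨z0, hz0⟩ := by
    intro μ _ h f
    have hint := hu.2.2 z0 hz0 _ (isJensen_map_of_subaveraging hX ⟨z0, hz0⟩ μ h)
    rw [hu0, eint_map hemb] at hint
    have hae := ae_nonneg_of_eint_nonneg (g := u ∘ Subtype.val)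
      (upperSemicontinuousOn_iff_restrict.2 hu.1).measurable
      (fun x => by
        rcases eq_or_ne (x : En n) z0 with hx | hx
        · exact (congrArg u hx).le.trans hu0.le
        · exact (huneg x x.2 hx).le) hint
    have hpt : ∀ᵐ x ∂μ, f x = f ⟨z0, hz0⟩ := by
      filter_upwards [hae] with x hx
      by_contra hne
      exact absurd hx (huneg x x.2 fun h => hne (congrArg f (Subtype.ext h))).not_ge
    rw [integral_congr_ae hpt]
    simp
  obtain ⟨v, hvK, hv0, hvneg⟩ := exists_peak_of_approx_peak (subaveragingCone (jensenOn X)) hconst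
    (fun f hf g hg => sup_mem_subaveragingCone hf hg) (isClosed_subaveragingCone _) ⟨z0, hz0⟩
    (fun f hf ε hε => exists_mem_le_add_of_unique_measure _ hconst _ huniq f hf hε)
  have hext : ∀ x : X, Function.extend Subtype.val (fun x => (v x : EReal)) 0 (x : En n) = v x :=
    fun x => Subtype.val_injective.extend_apply _ _ x
  refine ⟨_, psHce_extend hX hvK, ?_, fun w hw hne => ?_⟩
  · rw [hext ⟨z0, hz0⟩, hv0, EReal.coe_zero]
  · rw [hext ⟨w, hw⟩]
    exact_mod_cast hvneg ⟨w, hw⟩ fun h => hne (congrArg Subtype.val h)
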